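/- Let (X, d) be a metric space, let p ∈ X, and let ρ, η : [0, ∞) → X be unit-speed geodesic rays emanating from p, i.e. ρ(0) = η(0) = p and d(ρ(s), ρ(s')) = |s − s'|, d(η(t), η(t')) = |t − t'| for all s, s', t, t' ≥ 0. For s, t > 0 define the comparison angle θ̄(s, t) = arccos((s² + t² − d(ρ(s), η(t))²)/(2st)). Assume that for each fixed t > 0 the function s ↦ θ̄(s, t) is nonincreasing, and for each fixed s > 0 the function t ↦ θ̄(s, t) is nonincreasing. If there exist sequences s_k → ∞ and t_k → ∞ with θ̄(s_k, t_k) → π, then d(ρ(s), η(t)) = s + t for all s, t ≥ 0. -/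

import Mathlib

open Filter Topology

/-- Rigidity of comparison angles: if the comparison angles `θ̄(s,t)` of two unit-speed
geodesic rays from `p` are nonincreasing in each variable and tend to `π` along sequences
`s_k → ∞`, `t_k → ∞`, then `d(ρ(s), η(t)) = s + t` for all `s, t ≥ 0`. -/
theorem rays_opposite_of_comparison_angle_tendsto_pi
    {X : Type*} [MetricSpace X] (p : X) (ρ η : ℝ → X)
    (hρ0 : ρ 0 = p) (hη0 : η 0 = p)
    (hρ : ∀ s s' : ℝ, 0 ≤ s → 0 ≤ s' → dist (ρ s) (ρ s') = |s - s'|)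
    (hη : ∀ t t' : ℝ, 0 ≤ t → 0 ≤ t' → dist (η t) (η t') = |t - t'|)
    (θ : ℝ → ℝ → ℝ)
    (hθ : ∀ s t : ℝ, 0 < s → 0 < t →
      θ s t = Real.arccos ((s ^ 2 + t ^ 2 - dist (ρ s) (η t) ^ 2) / (2 * s * t)))
    (hmono_s : ∀ t : ℝ, 0 < t → ∀ s s' : ℝ, 0 < s → s ≤ s' → θ s' t ≤ θ s t)
    (hmono_t : ∀ s : ℝ, 0 < s → ∀ t t' : ℝ, 0 < t → t ≤ t' → θ s t' ≤ θ s t)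
    (sk tk : ℕ → ℝ) (hsk0 : ∀ k, 0 < sk k) (htk0 : ∀ k, 0 < tk k)
    (hsk : Tendsto sk atTop atTop) (htk : Tendsto tk atTop atTop)
    (hθlim : Tendsto (fun k => θ (sk k) (tk k)) atTop (𝓝 Real.pi)) :
    ∀ s t : ℝ, 0 ≤ s → 0 ≤ t → dist (ρ s) (η t) = s + t := by
  intro s t hs ht
  have hρs : dist (ρ s) p = s := by simpa [hρ0, abs_of_nonneg hs] using hρ s 0 hs le_rfl
  have hηt : dist p (η t) = t := by simpa [hη0, abs_of_nonneg ht] using hη 0 t le_rfl ht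
  rcases hs.eq_or_lt with rfl | hs
  · rw [hρ0, hηt, zero_add]
  rcases ht.eq_or_lt with rfl | ht
  · rw [hη0, hρs, add_zero]
  have hpi : Real.pi ≤ θ s t := by
    refine le_of_tendsto hθlim ?_
    filter_upwards [hsk.eventually_ge_atTop s, htk.eventually_ge_atTop t] with k hk hk'
    exact (hmono_s (tk k) (htk0 k) s (sk k) hs hk).trans (hmono_t s hs t (tk k) ht hk')
  rw [hθ s t hs ht] at hpi
  have hle := Real.arccos_eq_pi.1 ((Real.arccos_le_pi _).antisymm hpi)
  rw [div_le_iff₀ (by positivity)] at hle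
  refine le_antisymm ?_ (abs_le_of_sq_le_sq' (by linarith) dist_nonneg).2
  linarith [dist_triangle (ρ s) p (η t)]
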